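/- (Symmetry of the Lie-Verlet method) Let 𝕀 be an invertible 3×3 real matrix, τ a function from 3×3 real matrices to ℝ³, and h ∈ ℝ. Suppose Q₀, Q₁ are 3×3 real matrices and W₀, W₁, M ∈ ℝ³ satisfy the Lie-Verlet step with stepsize h: M = W₀ + (h/2)·𝕀⁻¹[(𝕀·M) × M − (h/2)·⟨M, 𝕀·M⟩·M + τ(Q₀)], Q₁ = Q₀·cay(h·M), and W₁ = M + (h/2)·𝕀⁻¹[(𝕀·M) × M + (h/2)·⟨M, 𝕀·M⟩·M + τ(Q₁)]. Then the Lie-Verlet step with stepsize −h starting from (Q₁, W₁) produces (Q₀, W₀): the same vector M satisfies M = W₁ + (−h/2)·𝕀⁻¹[(𝕀·M) × M − (−h/2)·⟨M, 𝕀·M⟩·M + τ(Q₁)], Q₁·cay(−h·M) = Q₀, and W₀ = M + (−h/2)·𝕀⁻¹[(𝕀·M) × M + (−h/2)·⟨M, 𝕀·M⟩·M + τ(Q₀)]. -/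

import Mathlib

open Matrix

/-- The hat map sending `x ∈ ℝ³` to the skew-symmetric matrix `x̂`
with `x̂ · y = x × y`. -/
def hat (x : Fin 3 → ℝ) : Matrix (Fin 3) (Fin 3) ℝ :=
  !![0, -x 2, x 1; x 2, 0, -x 0; -x 1, x 0, 0]

/-- The Euclidean norm on `ℝ³`. -/
noncomputable def enorm3 (x : Fin 3 → ℝ) : ℝ :=
  Real.sqrt (∑ i, x i ^ 2)

/-- The Euclidean inner product on `ℝ³`. -/
def dot3 (x y : Fin 3 → ℝ) : ℝ := ∑ i, x i * y i

/-- The Cayley map `cay(x) = I + (4/(4+‖x‖²))·x̂ + (2/(4+‖x‖²))·x̂²`. -/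
noncomputable def cay (x : Fin 3 → ℝ) : Matrix (Fin 3) (Fin 3) ℝ :=
  1 + (4 / (4 + enorm3 x ^ 2)) • hat x + (2 / (4 + enorm3 x ^ 2)) • (hat x * hat x)

/-- The cross product on `ℝ³`. -/
def cross3 (x y : Fin 3 → ℝ) : Fin 3 → ℝ :=
  ![x 1 * y 2 - x 2 * y 1, x 2 * y 0 - x 0 * y 2, x 0 * y 1 - x 1 * y 0]

theorem enorm3_sq (x : Fin 3 → ℝ) : enorm3 x ^ 2 = x 0 ^ 2 + x 1 ^ 2 + x 2 ^ 2 := by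
  rw [enorm3, Real.sq_sqrt (Finset.sum_nonneg fun i _ => sq_nonneg (x i)), Fin.sum_univ_three]

theorem enorm3_neg (x : Fin 3 → ℝ) : enorm3 (-x) = enorm3 x := by
  simp [enorm3]

theorem hat_neg (x : Fin 3 → ℝ) : hat (-x) = -hat x := by
  ext i j
  fin_cases i <;> fin_cases j <;> simp [hat]

theorem hat_mul_hat_mul_hat (x : Fin 3 → ℝ) :
    hat x * (hat x * hat x) = -(enorm3 x ^ 2) • hat x := by
  rw [enorm3_sq]
  ext i j
  fin_cases i <;> fin_cases j <;> simp [hat, Matrix.mul_apply, Fin.sum_univ_three] <;> ring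

theorem cay_mul_cay_neg (x : Fin 3 → ℝ) : cay x * cay (-x) = 1 := by
  have hpos : 4 + enorm3 x ^ 2 ≠ 0 := by positivity
  have hcoeff : 2 * (2 / (4 + enorm3 x ^ 2)) - (4 / (4 + enorm3 x ^ 2)) ^ 2
      - (2 / (4 + enorm3 x ^ 2)) ^ 2 * enorm3 x ^ 2 = 0 := by
    field_simp
    ring
  have hcube := hat_mul_hat_mul_hat x
  simp only [cay, enorm3_neg, hat_neg]
  generalize 4 / (4 + enorm3 x ^ 2) = a at *
  generalize 2 / (4 + enorm3 x ^ 2) = b at *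
  generalize enorm3 x ^ 2 = n at *
  generalize hat x = A at *
  calc (1 + a • A + b • (A * A)) * (1 + a • -A + b • (-A * -A))
      = 1 + (2 * b - a ^ 2) • (A * A) + b ^ 2 • (A * (A * (A * A))) := by
        simp only [mul_add, add_mul, smul_mul_assoc, mul_smul_comm, mul_assoc, neg_mul, mul_neg,
          neg_neg, one_mul, mul_one]
        module
    _ = 1 + (2 * b - a ^ 2 - b ^ 2 * n) • (A * A) := by
        rw [hcube, mul_smul_comm]
        module
    _ = 1 := by rw [hcoeff, zero_smul, add_zero]

/-- Symmetry of the Lie-Verlet method: a Lie-Verlet step of stepsize `h` from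
`(Q₀,W₀)` to `(Q₁,W₁)` implies a Lie-Verlet step of stepsize `−h` from `(Q₁,W₁)`
back to `(Q₀,W₀)`, with the same half-step velocity `M`. -/
theorem lie_verlet_symmetric
    (𝕀 : Matrix (Fin 3) (Fin 3) ℝ) (h𝕀 : IsUnit 𝕀)
    (τ : Matrix (Fin 3) (Fin 3) ℝ → Fin 3 → ℝ) (h : ℝ)
    (Q₀ Q₁ : Matrix (Fin 3) (Fin 3) ℝ) (W₀ W₁ M : Fin 3 → ℝ)
    (hM : M = W₀ + (h / 2) •
      (𝕀⁻¹ *ᵥ (cross3 (𝕀 *ᵥ M) M - (h / 2) • (dot3 M (𝕀 *ᵥ M) • M) + τ Q₀)))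
    (hQ : Q₁ = Q₀ * cay (h • M))
    (hW : W₁ = M + (h / 2) •
      (𝕀⁻¹ *ᵥ (cross3 (𝕀 *ᵥ M) M + (h / 2) • (dot3 M (𝕀 *ᵥ M) • M) + τ Q₁))) :
    M = W₁ + (-h / 2) •
      (𝕀⁻¹ *ᵥ (cross3 (𝕀 *ᵥ M) M - (-h / 2) • (dot3 M (𝕀 *ᵥ M) • M) + τ Q₁)) ∧
    Q₁ * cay ((-h) • M) = Q₀ ∧
    W₀ = M + (-h / 2) •
      (𝕀⁻¹ *ᵥ (cross3 (𝕀 *ᵥ M) M + (-h / 2) • (dot3 M (𝕀 *ᵥ M) • M) + τ Q₀)) := by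
  have hneg : -h / 2 = -(h / 2) := neg_div 2 h
  refine ⟨?_, ?_, ?_⟩
  · rw [hW, hneg, neg_smul, neg_smul, sub_neg_eq_add, add_neg_cancel_right]
  · rw [hQ, mul_assoc, neg_smul, cay_mul_cay_neg, mul_one]
  · rw [hneg, neg_smul, neg_smul, ← sub_eq_add_neg, ← sub_eq_add_neg]
    exact eq_sub_of_add_eq hM.symm
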